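/- There are constants c > 0 and C, depending only on c_1, such that for every r > 0, every positive integer s, every random variable X whose law lies in ℬ_{r,s}, every t ≥ 0, and every ℓ ≥ r: P(X ∈ [t, t + ℓ]) ≤ (C ℓ/(r √s)) · e^{−c t²/(r² s)}. -/

import Mathlib

open MeasureTheory ProbabilityTheory

/-- Binary convolution of laws on `ℝ`. -/
noncomputable def mconvR (μ ν : Measure ℝ) : Measure ℝ :=
  μ.bind (fun x => ν.map (fun y => x + y))

/-- Convolution of a finite family of laws on `ℝ`. -/
noncomputable def mconvFamR : {s : ℕ} → (Fin s → Measure ℝ) → Measure ℝ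
  | 0, _ => Measure.dirac 0
  | (_ + 1), ν => mconvR (ν 0) (mconvFamR (fun i => ν i.succ))

/-- The class `𝒟_r`: laws of real random variables `X` with `E X = 0`, `|X| ≤ 4r` a.s. and
`Var X ≥ c₁ (r/2)²`. -/
def MemD (c₁ r : ℝ) (ν : Measure ℝ) : Prop :=
  IsProbabilityMeasure ν ∧ (∫ x, x ∂ν) = 0 ∧ (∀ᵐ x ∂ν, |x| ≤ 4 * r) ∧
    c₁ * (r / 2) ^ 2 ≤ variance (fun x => x) ν

/-- The class `ℬ_{r,s}`: `s`-fold convolutions of laws from `𝒟_r`. -/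
def MemB (c₁ r : ℝ) (s : ℕ) (ν : Measure ℝ) : Prop :=
  ∃ f : Fin s → Measure ℝ, (∀ i, MemD c₁ r (f i)) ∧ ν = mconvFamR f

lemma mconvR_eq_conv (μ ν : Measure ℝ) [SFinite ν] : mconvR μ ν = μ.conv ν := by
  have hprod : Measurable fun x : ℝ => ν.map (Prod.mk x) := Measurable.map_prodMk_left
  have hsum : Measurable fun x : ℝ => (ν.map (Prod.mk x)).map fun p : ℝ × ℝ => p.1 + p.2 :=
    (Measure.measurable_map _ measurable_add).comp hprod
  have hmap : ∀ x : ℝ, ν.map (fun y => x + y)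
      = (ν.map (Prod.mk x)).map fun p : ℝ × ℝ => p.1 + p.2 := fun x =>
    (Measure.map_map measurable_add measurable_prodMk_left).symm
  ext A hA
  rw [mconvR, Measure.conv, Measure.map_apply measurable_add hA, Measure.prod,
    Measure.bind_apply (measurable_add hA) hprod.aemeasurable]
  simp_rw [hmap]
  rw [Measure.bind_apply hA hsum.aemeasurable]
  simp_rw [Measure.map_apply measurable_add hA]

lemma MemB.isProbabilityMeasure {c₁ r : ℝ} {s : ℕ} {ν : Measure ℝ} (h : MemB c₁ r s ν) :
    IsProbabilityMeasure ν := by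
  obtain ⟨f, hf, rfl⟩ := h
  induction s with
  | zero => exact Measure.dirac.isProbabilityMeasure
  | succ n ih =>
    have := ih (fun i => f i.succ) (fun i => hf i.succ)
    have := (hf 0).1
    rw [mconvFamR, mconvR_eq_conv]
    infer_instance

lemma memB_zero_iff {c₁ r : ℝ} {ν : Measure ℝ} : MemB c₁ r 0 ν ↔ ν = Measure.dirac 0 :=
  ⟨fun ⟨_, _, h⟩ => h, fun h => ⟨fun i => i.elim0, fun i => i.elim0, h⟩⟩

lemma memB_succ_iff {c₁ r : ℝ} {n : ℕ} {ν : Measure ℝ} :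
    MemB c₁ r (n + 1) ν ↔
      ∃ μ ν', MemD c₁ r μ ∧ MemB c₁ r n ν' ∧ ν = μ.conv ν' := by
  constructor
  · rintro ⟨f, hf, rfl⟩
    have hB : MemB c₁ r n (mconvFamR fun i => f i.succ) := ⟨_, fun i => hf i.succ, rfl⟩
    have := hB.isProbabilityMeasure
    exact ⟨f 0, _, hf 0, hB, by rw [mconvFamR, mconvR_eq_conv]⟩
  · rintro ⟨μ, ν', hμ, hν', rfl⟩
    have := hν'.isProbabilityMeasure
    obtain ⟨g, hg, rfl⟩ := hν'
    refine ⟨Fin.cons μ g, fun i => ?_, ?_⟩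
    · refine Fin.cases ?_ (fun j => ?_) i
      · simpa using hμ
      · simpa using hg j
    · simp [mconvFamR, mconvR_eq_conv]

/-- The classes `ℬ_{r,a}` and `ℬ_{r,b}` convolve onto `ℬ_{r,a+b}`. -/
lemma MemB.exists_conv {c₁ r : ℝ} {a b : ℕ} {ν : Measure ℝ} (h : MemB c₁ r (a + b) ν) :
    ∃ ν₁ ν₂, MemB c₁ r a ν₁ ∧ MemB c₁ r b ν₂ ∧ ν = ν₁.conv ν₂ := by
  induction a generalizing ν with
  | zero =>
    rw [Nat.zero_add] at h
    have := h.isProbabilityMeasure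
    exact ⟨_, ν, memB_zero_iff.2 rfl, h, (Measure.dirac_zero_conv ν).symm⟩
  | succ a ih =>
    rw [Nat.add_right_comm, memB_succ_iff] at h
    obtain ⟨μ, ν', hμ, hν', rfl⟩ := h
    obtain ⟨ν₁, ν₂, h₁, h₂, rfl⟩ := ih hν'
    have := hμ.1
    have := h₁.isProbabilityMeasure
    have := h₂.isProbabilityMeasure
    exact ⟨μ.conv ν₁, ν₂, memB_succ_iff.2 ⟨μ, ν₁, hμ, h₁, rfl⟩, h₂,
      (Measure.conv_assoc μ ν₁ ν₂).symm⟩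

lemma MemD.hasSubgaussianMGF {c₁ r : ℝ} {ν : Measure ℝ} (h : MemD c₁ r ν) :
    HasSubgaussianMGF id ((‖4 * r - -(4 * r)‖₊ / 2) ^ 2) ν := by
  have := h.1
  refine hasSubgaussianMGF_of_mem_Icc_of_integral_eq_zero aemeasurable_id ?_ h.2.1
  filter_upwards [h.2.2.1] with x hx using abs_le.1 hx

lemma ProbabilityTheory.HasSubgaussianMGF.id_conv {μ ν : Measure ℝ} [IsProbabilityMeasure μ]
    [IsProbabilityMeasure ν] {a b : NNReal} (hμ : HasSubgaussianMGF id a μ)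
    (hν : HasSubgaussianMGF id b ν) : HasSubgaussianMGF id (a + b) (μ.conv ν) := by
  rw [Measure.conv, HasSubgaussianMGF.id_map_iff measurable_add.aemeasurable]
  have h1 : HasSubgaussianMGF (Prod.fst : ℝ × ℝ → ℝ) a (μ.prod ν) := by
    rw [← HasSubgaussianMGF.id_map_iff measurable_fst.aemeasurable]
    simpa using hμ
  have h2 : HasSubgaussianMGF (Prod.snd : ℝ × ℝ → ℝ) b (μ.prod ν) := by
    rw [← HasSubgaussianMGF.id_map_iff measurable_snd.aemeasurable]
    simpa using hν
  exact h1.add_of_indepFun h2 (indepFun_prod measurable_id measurable_id)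

lemma MemB.hasSubgaussianMGF {c₁ r : ℝ} {n : ℕ} {ν : Measure ℝ} (h : MemB c₁ r n ν) :
    HasSubgaussianMGF id (n * (‖4 * r - -(4 * r)‖₊ / 2) ^ 2) ν := by
  induction n generalizing ν with
  | zero =>
    rw [memB_zero_iff] at h
    subst h
    exact ⟨fun t => integrable_dirac (by simp), fun t => by simp [mgf]⟩
  | succ n ih =>
    obtain ⟨μ, ν', hμ, hν', rfl⟩ := memB_succ_iff.1 h
    have := hμ.1
    have := hν'.isProbabilityMeasure
    have := HasSubgaussianMGF.id_conv hμ.hasSubgaussianMGF (ih hν')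
    convert this using 1
    push_cast
    ring

lemma ProbabilityTheory.HasSubgaussianMGF.mono {Ω : Type*} [MeasurableSpace Ω] {μ : Measure Ω} {X : Ω → ℝ}
    {a b : NNReal} (h : HasSubgaussianMGF X a μ) (hab : a ≤ b) : HasSubgaussianMGF X b μ :=
  ⟨h.integrable_exp_mul, fun t => (h.mgf_le t).trans (by gcongr)⟩

lemma MemB.measureReal_Ici_le {c₁ r : ℝ} {n s : ℕ} (hns : n ≤ s) {ν : Measure ℝ}
    (h : MemB c₁ r n ν) {T : ℝ} (hT : 0 ≤ T) :
    ν.real (Set.Ici T) ≤ Real.exp (-T ^ 2 / (32 * (r ^ 2 * s))) := by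
  have h1 := (h.hasSubgaussianMGF.mono (b := s * (‖4 * r - -(4 * r)‖₊ / 2) ^ 2)
    (by gcongr)).measure_ge_le hT
  refine h1.trans_eq ?_
  congr 2
  have h2 : ‖4 * r - -(4 * r)‖ ^ 2 = 64 * r ^ 2 := by
    rw [Real.norm_eq_abs, sq_abs]; ring
  push_cast
  rw [div_pow, h2]
  ring

lemma norm_cexp_sub_le {y : ℝ} (hy : |y| ≤ 1 / 4) :
    ‖Complex.exp (y * Complex.I) - y * Complex.I‖ ≤ 1 - y ^ 2 / 4 := by
  have hn : ‖(y * Complex.I : ℂ)‖ = |y| := by simp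
  have h := Complex.exp_bound (x := y * Complex.I) (by rw [hn]; linarith) (n := 3) (by norm_num)
  rw [hn] at h
  have hsum : ∑ m ∈ Finset.range 3, (y * Complex.I : ℂ) ^ m / (m.factorial : ℂ)
      = ((1 - y ^ 2 / 2 : ℝ) : ℂ) + y * Complex.I := by
    simp [Finset.sum_range_succ, Nat.factorial, mul_pow]
    ring
  rw [hsum] at h
  have hy2 : y ^ 2 ≤ 1 / 16 := by
    rw [← sq_abs]; nlinarith [abs_nonneg y]
  have h3 : |y| ^ 3 ≤ y ^ 2 / 4 := by
    rw [pow_succ, sq_abs]; nlinarith [sq_nonneg y]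
  have hre : ‖((1 - y ^ 2 / 2 : ℝ) : ℂ)‖ = 1 - y ^ 2 / 2 := by
    rw [Complex.norm_real, Real.norm_eq_abs, abs_of_nonneg (by linarith)]
  norm_num [Nat.factorial] at h
  calc ‖Complex.exp (y * Complex.I) - y * Complex.I‖
      = ‖(Complex.exp (y * Complex.I) - (((1 - y ^ 2 / 2 : ℝ) : ℂ) + y * Complex.I))
          + ((1 - y ^ 2 / 2 : ℝ) : ℂ)‖ := by congr 1; ring
    _ ≤ _ + _ := norm_add_le _ _
    _ ≤ 1 - y ^ 2 / 4 := by
      rw [hre]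
      push_cast
      linarith [sq_nonneg y]

lemma MemD.norm_charFun_le {c₁ r : ℝ} {ν : Measure ℝ} (h : MemD c₁ r ν) {θ : ℝ}
    (hθ : |θ| * (16 * r) ≤ 1) :
    ‖charFun ν θ‖ ≤ Real.exp (-(c₁ * r ^ 2 / 16) * θ ^ 2) := by
  obtain ⟨hp, h0, hb, hv⟩ := h
  have hbd : MemLp (fun x : ℝ => x) 2 ν :=
    MemLp.of_bound aestronglyMeasurable_id (4 * r) (by simpa using hb)
  have hint : Integrable (fun x : ℝ => x) ν := hbd.integrable (by norm_num)
  have hint2 : Integrable (fun x : ℝ => x ^ 2) ν := hbd.integrable_sq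
  have hv2 : variance (fun x : ℝ => x) ν = ∫ x, x ^ 2 ∂ν := by
    rw [variance_eq_sub hbd, h0]
    simp
  have hexp : Integrable (fun x : ℝ => Complex.exp (((θ * x : ℝ) : ℂ) * Complex.I)) ν :=
    Integrable.of_bound (by fun_prop) 1 (by
      filter_upwards with x
      rw [Complex.norm_exp_ofReal_mul_I])
  have hlin : Integrable (fun x : ℝ => ((θ * x : ℝ) : ℂ) * Complex.I) ν :=
    ((hint.const_mul θ).ofReal).mul_const _
  have hφ : charFun ν θ = ∫ x : ℝ, (Complex.exp (((θ * x : ℝ) : ℂ) * Complex.I)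
      - ((θ * x : ℝ) : ℂ) * Complex.I) ∂ν := by
    rw [integral_sub hexp hlin, integral_mul_const, integral_complex_ofReal, integral_const_mul, h0,
      charFun_apply_real]
    simp
  have hle : ‖charFun ν θ‖ ≤ ∫ x, (1 - (θ * x) ^ 2 / 4) ∂ν := by
    rw [hφ]
    refine norm_integral_le_of_norm_le ?_ ?_
    · simp_rw [mul_pow]
      exact (integrable_const _).sub ((hint2.const_mul _).div_const _)
    · filter_upwards [hb] with x hx
      refine norm_cexp_sub_le ?_
      rw [abs_mul]
      nlinarith [abs_nonneg θ, abs_nonneg x]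
  have heq : ∫ x, (1 - (θ * x) ^ 2 / 4) ∂ν = 1 - θ ^ 2 * (∫ x, x ^ 2 ∂ν) / 4 := by
    simp_rw [mul_pow]
    rw [integral_sub (integrable_const _) ((hint2.const_mul _).div_const _), integral_div,
      integral_const_mul]
    simp
  rw [hv2] at hv
  have := Real.add_one_le_exp (-(c₁ * r ^ 2 / 16) * θ ^ 2)
  nlinarith [sq_nonneg θ, mul_le_mul_of_nonneg_left hv (sq_nonneg θ)]

lemma MemB.norm_charFun_le {c₁ r : ℝ} {n : ℕ} {ν : Measure ℝ} (h : MemB c₁ r n ν) {θ : ℝ}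
    (hθ : |θ| * (16 * r) ≤ 1) :
    ‖charFun ν θ‖ ≤ Real.exp (-(n * (c₁ * r ^ 2 / 16)) * θ ^ 2) := by
  induction n generalizing ν with
  | zero =>
    rw [memB_zero_iff] at h
    subst h
    simp
  | succ n ih =>
    obtain ⟨μ, ν', hμ, hν', rfl⟩ := memB_succ_iff.1 h
    have := hμ.1
    have := hν'.isProbabilityMeasure
    rw [charFun_conv, norm_mul]
    refine (mul_le_mul (hμ.norm_charFun_le hθ) (ih hν') (norm_nonneg _)
      (Real.exp_pos _).le).trans_eq ?_
    rw [← Real.exp_add]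
    push_cast
    congr 1
    ring

/-- The Fejér kernel in closed form. -/
lemma integral_sub_mul_cos (δ : ℝ) {u : ℝ} (hu : u ≠ 0) :
    ∫ θ in (0 : ℝ)..δ, (δ - θ) * Real.cos (θ * u) = (1 - Real.cos (δ * u)) / u ^ 2 := by
  have hd : ∀ θ ∈ Set.uIcc 0 δ, HasDerivAt
      (fun θ => (δ - θ) * (Real.sin (θ * u) / u) - Real.cos (θ * u) / u ^ 2)
      ((δ - θ) * Real.cos (θ * u)) θ := by
    intro θ _
    have hm : HasDerivAt (fun θ : ℝ => θ * u) u θ := by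
      simpa using (hasDerivAt_id θ).mul_const u
    have h1 := ((hasDerivAt_id θ).const_sub δ).mul (hm.sin.div_const u)
    convert! h1.sub (hm.cos.div_const (u ^ 2)) using 1
    simp only [id]
    field_simp
    ring
  rw [intervalIntegral.integral_eq_sub_of_hasDerivAt hd
    (Continuous.intervalIntegrable (by fun_prop) _ _)]
  simp
  ring

lemma integral_sub_mul_cos_nonneg {δ : ℝ} (hδ : 0 ≤ δ) (u : ℝ) :
    0 ≤ ∫ θ in (0 : ℝ)..δ, (δ - θ) * Real.cos (θ * u) := by
  by_cases hu : u = 0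
  · subst hu
    refine intervalIntegral.integral_nonneg hδ fun θ hθ => ?_
    simpa using hθ.2
  · rw [integral_sub_mul_cos δ hu]
    exact div_nonneg (by linarith [Real.cos_le_one (δ * u)]) (sq_nonneg u)

lemma le_integral_sub_mul_cos {δ u : ℝ} (hδ : 0 ≤ δ) (hu : δ * |u| ≤ 1) :
    δ ^ 2 / 4 ≤ ∫ θ in (0 : ℝ)..δ, (δ - θ) * Real.cos (θ * u) := by
  have h : ∫ θ in (0 : ℝ)..δ, (δ - θ) * (1 / 2) = δ ^ 2 / 4 := by
    rw [intervalIntegral.integral_mul_const, intervalIntegral.integral_sub (by simp) (by simp)]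
    simp
    ring
  rw [← h]
  refine intervalIntegral.integral_mono_on hδ (Continuous.intervalIntegrable (by fun_prop) _ _)
    (Continuous.intervalIntegrable (by fun_prop) _ _) fun θ hθ => ?_
  have h1 : |θ * u| ≤ 1 := by
    rw [abs_mul, abs_of_nonneg hθ.1]
    exact (mul_le_mul_of_nonneg_right hθ.2 (abs_nonneg u)).trans hu
  have h2 := Real.one_sub_sq_div_two_le_cos (x := θ * u)
  have h3 : (θ * u) ^ 2 ≤ 1 := by
    rw [← sq_abs]; nlinarith [abs_nonneg (θ * u)]
  exact mul_le_mul_of_nonneg_left (by linarith) (by linarith [hθ.2])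

lemma integral_cos_le_norm_charFun (ν : Measure ℝ) [IsProbabilityMeasure ν] (θ x : ℝ) :
    ∫ y, Real.cos (θ * (y - x)) ∂ν ≤ ‖charFun ν θ‖ := by
  have hint : Integrable (fun y : ℝ => Complex.exp (((θ * (y - x) : ℝ) : ℂ) * Complex.I)) ν :=
    Integrable.of_bound (by fun_prop) 1 (by
      filter_upwards with y
      rw [Complex.norm_exp_ofReal_mul_I])
  have h1 : ∫ y, Real.cos (θ * (y - x)) ∂ν
      = (∫ y : ℝ, Complex.exp (((θ * (y - x) : ℝ) : ℂ) * Complex.I) ∂ν).re := by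
    have := integral_re hint
    simp only [RCLike.re_to_complex, Complex.exp_ofReal_mul_I_re] at this
    exact this
  have h2 : ∫ y : ℝ, Complex.exp (((θ * (y - x) : ℝ) : ℂ) * Complex.I) ∂ν
      = charFun ν θ * Complex.exp (((-(θ * x) : ℝ) : ℂ) * Complex.I) := by
    rw [charFun_apply_real, ← integral_mul_const]
    congr 1
    ext y
    rw [← Complex.exp_add]
    congr 1
    push_cast
    ring
  rw [h1, h2]
  refine (Complex.re_le_norm _).trans ?_
  rw [norm_mul, Complex.norm_exp_ofReal_mul_I, mul_one]

/-- Esseen's concentration inequality. -/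
lemma measureReal_Icc_le_integral_norm_charFun (ν : Measure ℝ) [IsProbabilityMeasure ν]
    {δ ℓ : ℝ} (hδ : 0 < δ) (hℓ : δ * ℓ ≤ 1) (x : ℝ) :
    ν.real (Set.Icc x (x + ℓ)) ≤ 4 / δ * ∫ θ in (0 : ℝ)..δ, ‖charFun ν θ‖ := by
  have hprod : Integrable (Function.uncurry fun y θ : ℝ => (δ - θ) * Real.cos (θ * (y - x)))
      (ν.prod (volume.restrict (Set.Ioc 0 δ))) := by
    have hle : ∀ᵐ p ∂(ν.prod (volume.restrict (Set.Ioc (0 : ℝ) δ))), p.2 ∈ Set.Ioc 0 δ :=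
      Measure.quasiMeasurePreserving_snd.ae (ae_restrict_mem measurableSet_Ioc)
    refine Integrable.of_bound (Continuous.aestronglyMeasurable (by fun_prop)) δ ?_
    filter_upwards [hle] with p hp
    rw [Function.uncurry, norm_mul, Real.norm_eq_abs, Real.norm_eq_abs,
      abs_of_nonneg (by linarith [hp.2])]
    calc (δ - p.2) * |Real.cos (p.2 * (p.1 - x))| ≤ (δ - p.2) * 1 :=
          mul_le_mul_of_nonneg_left (Real.abs_cos_le_one _) (by linarith [hp.2])
      _ ≤ δ := by linarith [hp.1]
  have hK : Integrable (fun y => ∫ θ in (0 : ℝ)..δ, (δ - θ) * Real.cos (θ * (y - x))) ν := by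
    simp_rw [intervalIntegral.integral_of_le hδ.le]
    exact hprod.integral_prod_left
  have hswap : ∫ y, (∫ θ in (0 : ℝ)..δ, (δ - θ) * Real.cos (θ * (y - x))) ∂ν
      = ∫ θ in (0 : ℝ)..δ, ∫ y, (δ - θ) * Real.cos (θ * (y - x)) ∂ν := by
    simp_rw [intervalIntegral.integral_of_le hδ.le]
    exact integral_integral_swap hprod
  have hlow : δ ^ 2 / 4 * ν.real (Set.Icc x (x + ℓ))
      ≤ ∫ y, (∫ θ in (0 : ℝ)..δ, (δ - θ) * Real.cos (θ * (y - x))) ∂ν := by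
    have : ∫ y, (Set.Icc x (x + ℓ)).indicator (fun _ => δ ^ 2 / 4) y ∂ν
        = δ ^ 2 / 4 * ν.real (Set.Icc x (x + ℓ)) := by
      rw [integral_indicator_const _ measurableSet_Icc, smul_eq_mul, mul_comm]
    rw [← this]
    refine integral_mono ((integrable_const _).indicator measurableSet_Icc) hK fun y => ?_
    by_cases hy : y ∈ Set.Icc x (x + ℓ)
    · rw [Set.indicator_of_mem hy]
      refine le_integral_sub_mul_cos hδ.le ?_
      rw [abs_of_nonneg (by linarith [hy.1])]
      exact (mul_le_mul_of_nonneg_left (by linarith [hy.2]) hδ.le).trans hℓ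
    · rw [Set.indicator_of_notMem hy]
      exact integral_sub_mul_cos_nonneg hδ.le _
  have hφ : IntervalIntegrable (fun θ => ‖charFun ν θ‖) volume 0 δ :=
    Continuous.intervalIntegrable (by fun_prop) _ _
  have hup : ∫ θ in (0 : ℝ)..δ, ∫ y, (δ - θ) * Real.cos (θ * (y - x)) ∂ν
      ≤ δ * ∫ θ in (0 : ℝ)..δ, ‖charFun ν θ‖ := by
    rw [← intervalIntegral.integral_const_mul]
    refine intervalIntegral.integral_mono_on hδ.le ?_ (hφ.const_mul _) fun θ hθ => ?_
    · rw [intervalIntegrable_iff_integrableOn_Ioc_of_le hδ.le]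
      exact hprod.integral_prod_right
    · rw [integral_const_mul]
      calc (δ - θ) * ∫ y, Real.cos (θ * (y - x)) ∂ν ≤ (δ - θ) * ‖charFun ν θ‖ :=
            mul_le_mul_of_nonneg_left (integral_cos_le_norm_charFun ν θ x) (by linarith [hθ.2])
        _ ≤ δ * ‖charFun ν θ‖ :=
            mul_le_mul_of_nonneg_right (by linarith [hθ.1]) (norm_nonneg _)
  have := (hlow.trans_eq hswap).trans hup
  have h4 : 4 / δ * (∫ θ in (0 : ℝ)..δ, ‖charFun ν θ‖)
      = 4 / δ ^ 2 * (δ * ∫ θ in (0 : ℝ)..δ, ‖charFun ν θ‖) := by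
    field_simp
  rw [h4]
  calc ν.real (Set.Icc x (x + ℓ)) = 4 / δ ^ 2 * (δ ^ 2 / 4 * ν.real (Set.Icc x (x + ℓ))) := by
        field_simp
    _ ≤ _ := mul_le_mul_of_nonneg_left this (by positivity)

lemma intervalIntegral_exp_neg_mul_sq_le {b δ : ℝ} (hb : 0 < b) (hδ : 0 ≤ δ) :
    ∫ θ in (0 : ℝ)..δ, Real.exp (-b * θ ^ 2) ≤ √(Real.pi / b) := by
  rw [intervalIntegral.integral_of_le hδ]
  refine (setIntegral_le_integral (integrable_exp_neg_mul_sq hb) ?_).trans_eq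
    (integral_gaussian b)
  filter_upwards with θ using (Real.exp_pos _).le

lemma MemB.measureReal_Icc_le {c₁ r : ℝ} (hc₁ : 0 < c₁) (hr : 0 < r) {n : ℕ} {ν : Measure ℝ}
    (h : MemB c₁ r n ν) {ℓ : ℝ} (hℓ : r ≤ ℓ) (x : ℝ) :
    ν.real (Set.Icc x (x + ℓ))
      ≤ 256 * Real.exp c₁ * √(Real.pi / c₁) * ℓ / (r * √(n + 1)) := by
  have hp := h.isProbabilityMeasure
  have hℓ0 : 0 < ℓ := hr.trans_le hℓ
  have hδ : 0 < 1 / (16 * ℓ) := by positivity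
  set b : ℝ := (n + 1) * (c₁ * r ^ 2 / 16) with hb
  have hb0 : 0 < b := by positivity
  have hφ : ∀ θ ∈ Set.Icc 0 (1 / (16 * ℓ)),
      ‖charFun ν θ‖ ≤ Real.exp c₁ * Real.exp (-b * θ ^ 2) := by
    intro θ hθ
    have h16 : θ * (16 * r) ≤ 1 := by
      have := (le_div_iff₀ (by positivity)).1 hθ.2
      nlinarith [hθ.1]
    have h1 := h.norm_charFun_le (θ := θ) (by rwa [abs_of_nonneg hθ.1])
    refine h1.trans ?_
    rw [← Real.exp_add]
    refine Real.exp_le_exp.2 ?_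
    have h0 : 0 ≤ θ * (16 * r) := mul_nonneg hθ.1 (by positivity)
    have h2 : (θ * (16 * r)) ^ 2 ≤ 1 := by nlinarith
    have h3 : c₁ * (θ * (16 * r)) ^ 2 ≤ c₁ * 1 := mul_le_mul_of_nonneg_left h2 hc₁.le
    rw [hb]
    nlinarith
  have hint : ∫ θ in (0 : ℝ)..1 / (16 * ℓ), ‖charFun ν θ‖
      ≤ Real.exp c₁ * √(Real.pi / b) := by
    refine (intervalIntegral.integral_mono_on hδ.le
      (Continuous.intervalIntegrable (by fun_prop) _ _)
      (Continuous.intervalIntegrable (by fun_prop) _ _) hφ).trans ?_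
    rw [intervalIntegral.integral_const_mul]
    exact mul_le_mul_of_nonneg_left (intervalIntegral_exp_neg_mul_sq_le hb0 hδ.le)
      (Real.exp_pos _).le
  have hsqrt : √(Real.pi / b) = 4 * √(Real.pi / c₁) / (r * √(n + 1)) := by
    have : Real.pi / b = (4 / r) ^ 2 * (Real.pi / c₁) / (n + 1) := by
      rw [hb]; field_simp; norm_num
    rw [this, Real.sqrt_div (by positivity), Real.sqrt_mul (by positivity),
      Real.sqrt_sq (by positivity)]
    field_simp
  calc ν.real (Set.Icc x (x + ℓ))
      ≤ 4 / (1 / (16 * ℓ)) * ∫ θ in (0 : ℝ)..1 / (16 * ℓ), ‖charFun ν θ‖ :=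
        measureReal_Icc_le_integral_norm_charFun ν hδ
          (by rw [div_mul_eq_mul_div, div_le_one (by positivity)]; linarith) x
    _ ≤ 4 / (1 / (16 * ℓ)) * (Real.exp c₁ * √(Real.pi / b)) :=
        mul_le_mul_of_nonneg_left hint (by positivity)
    _ = _ := by
        rw [hsqrt]
        field_simp
        norm_num

lemma prod_le_fst_inter_add_mem_Icc_le (μ ν : Measure ℝ) [IsProbabilityMeasure μ]
    [IsProbabilityMeasure ν] {K ℓ : ℝ} (hK : ∀ x, ν.real (Set.Icc x (x + ℓ)) ≤ K) (T t : ℝ) :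
    (μ.prod ν).real {p | T ≤ p.1 ∧ p.1 + p.2 ∈ Set.Icc t (t + ℓ)} ≤ K * μ.real (Set.Ici T) := by
  have hK0 : 0 ≤ K := measureReal_nonneg.trans (hK 0)
  have hmeas : MeasurableSet {p : ℝ × ℝ | T ≤ p.1 ∧ p.1 + p.2 ∈ Set.Icc t (t + ℓ)} :=
    (measurableSet_le measurable_const measurable_fst).inter
      (measurable_add measurableSet_Icc)
  have hle : (μ.prod ν) {p | T ≤ p.1 ∧ p.1 + p.2 ∈ Set.Icc t (t + ℓ)}
      ≤ ENNReal.ofReal K * μ (Set.Ici T) := by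
    rw [Measure.prod_apply hmeas, ← lintegral_indicator_const measurableSet_Ici]
    refine lintegral_mono fun x => ?_
    by_cases hx : x ∈ Set.Ici T
    · rw [Set.indicator_of_mem hx]
      refine (measure_mono (t := Set.Icc (t - x) (t - x + ℓ)) ?_).trans
        ((ENNReal.le_ofReal_iff_toReal_le (measure_ne_top _ _) hK0).2 (hK _))
      rintro y ⟨-, h1, h2⟩
      exact ⟨by simp only at h1; linarith, by simp only at h2; linarith⟩
    · rw [Set.indicator_of_notMem hx]
      refine (measure_mono_null (t := ∅) ?_ measure_empty).le
      rintro y ⟨h, -⟩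
      exact hx h
  refine (ENNReal.toReal_mono (by finiteness) hle).trans_eq ?_
  rw [ENNReal.toReal_mul, ENNReal.toReal_ofReal hK0]
  rfl

/-- If a sum of two independent variables is at least `t`, one of them is at least `t / 2`, and the
other one must then lie in an interval of length `ℓ`. -/
lemma conv_real_Icc_le (μ ν : Measure ℝ) [IsProbabilityMeasure μ]
    [IsProbabilityMeasure ν] {K ℓ : ℝ} (hμ : ∀ x, μ.real (Set.Icc x (x + ℓ)) ≤ K)
    (hν : ∀ x, ν.real (Set.Icc x (x + ℓ)) ≤ K) (t : ℝ) :
    (μ.conv ν).real (Set.Icc t (t + ℓ))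
      ≤ K * μ.real (Set.Ici (t / 2)) + K * ν.real (Set.Ici (t / 2)) := by
  set A := {p : ℝ × ℝ | t / 2 ≤ p.1 ∧ p.1 + p.2 ∈ Set.Icc t (t + ℓ)}
  have hmeas : MeasurableSet A :=
    (measurableSet_le measurable_const measurable_fst).inter (measurable_add measurableSet_Icc)
  have hswap : (μ.prod ν).real (Prod.swap ⁻¹' A) = (ν.prod μ).real A := by
    rw [← Measure.prod_swap (μ := μ) (ν := ν), map_measureReal_apply measurable_swap hmeas]
  rw [Measure.conv, map_measureReal_apply measurable_add measurableSet_Icc]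
  calc (μ.prod ν).real ((fun p : ℝ × ℝ => p.1 + p.2) ⁻¹' Set.Icc t (t + ℓ))
      ≤ (μ.prod ν).real (A ∪ Prod.swap ⁻¹' A) := by
        refine measureReal_mono fun p hp => ?_
        have hp' : p.1 + p.2 ∈ Set.Icc t (t + ℓ) := hp
        rcases le_or_gt (t / 2) p.1 with h | h
        · exact Or.inl ⟨h, hp'⟩
        · exact Or.inr ⟨by simp only [Prod.fst_swap]; linarith [hp'.1],
            by simpa [add_comm] using hp'⟩
    _ ≤ (μ.prod ν).real A + (μ.prod ν).real (Prod.swap ⁻¹' A) := measureReal_union_le _ _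
    _ ≤ _ := by
        rw [hswap]
        exact add_le_add (prod_le_fst_inter_add_mem_Icc_le μ ν hν _ _)
          (prod_le_fst_inter_add_mem_Icc_le ν μ hμ _ _)


/-- **Tail bound for the class `ℬ_{r,s}`.**  There are constants `c > 0` and `C`, depending
only on `c₁`, such that any random variable `X` with law in `ℬ_{r,s}` satisfies
`P(X ∈ [t, t+ℓ]) ≤ (Cℓ/(r√s)) e^{-ct²/(r²s)}` for all `t ≥ 0` and `ℓ ≥ r`. -/
theorem memB_tail_bound (c₁ : ℝ) (hc₁ : 0 < c₁) :
    ∃ c : ℝ, 0 < c ∧ ∃ C : ℝ,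
      ∀ (r : ℝ), 0 < r → ∀ (s : ℕ), 0 < s →
      ∀ {Ω : Type} [MeasurableSpace Ω] (P : Measure Ω) [IsProbabilityMeasure P]
        (X : Ω → ℝ), Measurable X → MemB c₁ r s (P.map X) →
        ∀ t : ℝ, 0 ≤ t → ∀ ℓ : ℝ, r ≤ ℓ →
          (P {ω | X ω ∈ Set.Icc t (t + ℓ)}).toReal
            ≤ C * ℓ / (r * Real.sqrt s) * Real.exp (-c * t ^ 2 / (r ^ 2 * s)) := by
  set M : ℝ := 256 * Real.exp c₁ * √(Real.pi / c₁)
  have hM0 : 0 < M := by positivity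
  refine ⟨1 / 128, by norm_num, 4 * M, ?_⟩
  intro r hr s hs Ω _ P _ X hX hB t ht ℓ hℓ
  have hℓ0 : 0 < ℓ := hr.trans_le hℓ
  have hs0 : (0 : ℝ) < s := by exact_mod_cast hs
  have hsum : s / 2 + (s - s / 2) = s := by omega
  obtain ⟨ν₁, ν₂, h₁, h₂, hconv⟩ :=
    MemB.exists_conv (a := s / 2) (b := s - s / 2) (by rwa [hsum])
  have := h₁.isProbabilityMeasure
  have := h₂.isProbabilityMeasure
  have hK : ∀ n : ℕ, s ≤ 4 * (n + 1) → M * ℓ / (r * √(n + 1)) ≤ 2 * M * ℓ / (r * √s) := by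
    intro n hn
    have h4 : (s : ℝ) ≤ 2 ^ 2 * (n + 1) := by norm_num; exact_mod_cast hn
    have h5 : √s ≤ 2 * √(n + 1) := by
      refine (Real.sqrt_le_sqrt h4).trans_eq ?_
      rw [Real.sqrt_mul (by norm_num), Real.sqrt_sq (by norm_num)]
    rw [div_le_div_iff₀ (by positivity) (by positivity)]
    nlinarith [mul_le_mul_of_nonneg_left h5 (show 0 ≤ M * ℓ * r by positivity)]
  have key := conv_real_Icc_le ν₁ ν₂
    (fun x => (h₁.measureReal_Icc_le hc₁ hr hℓ x).trans (hK _ (by omega)))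
    (fun x => (h₂.measureReal_Icc_le hc₁ hr hℓ x).trans (hK _ (by omega))) t
  have hexp : Real.exp (-(t / 2) ^ 2 / (32 * (r ^ 2 * s)))
      = Real.exp (-(1 / 128) * t ^ 2 / (r ^ 2 * s)) := by
    congr 1
    field_simp
    ring
  have e₁ := h₁.measureReal_Ici_le (s := s) (by omega) (T := t / 2) (by linarith)
  have e₂ := h₂.measureReal_Ici_le (s := s) (by omega) (T := t / 2) (by linarith)
  rw [hexp] at e₁ e₂
  have hP : (P {ω | X ω ∈ Set.Icc t (t + ℓ)}).toReal
      = (ν₁.conv ν₂).real (Set.Icc t (t + ℓ)) := by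
    rw [← hconv, map_measureReal_apply hX measurableSet_Icc]
    rfl
  rw [hP]
  have hnn : 0 ≤ 2 * M * ℓ / (r * √s) := by positivity
  refine (key.trans (add_le_add (mul_le_mul_of_nonneg_left e₁ hnn)
    (mul_le_mul_of_nonneg_left e₂ hnn))).trans_eq ?_
  ring
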